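/- arXiv:1611.05985 — 2 statements merged into one kernel-verified Lean document; each statement's English description precedes it below -/
import Mathlib

section
/- Let n, m, s > 0 with s ≤ n, and set δ = C̃₁·( (s/m)·log(2n/s) )^{1/5}. Let a_1, …, a_m be independent standard Gaussian random vectors in ℝⁿ. Then with probability at least 1 − C̃₂·exp(−c̃·δ·m), the following holds uniformly over all x, x̂ ∈ ℝⁿ with ‖x‖₂ = ‖x̂‖₂ = 1, ‖x‖₁ ≤ √s, and ‖x̂‖₁ ≤ √s: if ⟨a_i, x̂⟩·⟨a_i, x⟩ ≥ 0 for every i = 1…m, then ‖x̂ − x‖₂ ≤ δ. Here C̃₁, C̃₂, c̃ are positive universal constants. -/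
open MeasureTheory ProbabilityTheory

/-- The ℓ² (Euclidean) norm on ℝⁿ. -/
noncomputable def l2norm {n : ℕ} (x : Fin n → ℝ) : ℝ := Real.sqrt (∑ j, (x j) ^ 2)

/-- The ℓ¹ norm on ℝⁿ. -/
noncomputable def l1norm {n : ℕ} (x : Fin n → ℝ) : ℝ := ∑ j, |x j|

/-- The Euclidean inner product on ℝⁿ. -/
noncomputable def dot {n : ℕ} (x y : Fin n → ℝ) : ℝ := ∑ j, x j * y j

/-- The joint law of `m` independent standard Gaussian random vectors in ℝⁿ:
each of the `m * n` coordinates is an independent standard normal. -/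
noncomputable def stdGaussianVectors (m n : ℕ) : Measure (Fin m → Fin n → ℝ) :=
  Measure.pi fun _ : Fin m => Measure.pi fun _ : Fin n => gaussianReal 0 1

open scoped ENNReal NNReal

section Gaussian

variable {Ω : Type*} [MeasurableSpace Ω] {P : Measure Ω}

lemma iIndepFun_hasLaw_linearCombination {κ ι : Type*} [Fintype κ] [Fintype ι]
    {Z : κ → Ω → ℝ} (hZ : iIndepFun Z P) (hl : ∀ k, HasLaw (Z k) (gaussianReal 0 1) P)
    (c : ι → κ → ℝ) (hc : ∀ i j, i ≠ j → ∑ k, c i k * c j k = 0) :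
    iIndepFun (fun i ω => ∑ k, c i k * Z k ω) P ∧
      ∀ i, HasLaw (fun ω => ∑ k, c i k * Z k ω)
        (gaussianReal 0 (∑ k, c i k ^ 2).toNNReal) P := by
  classical
  have hP := hZ.isProbabilityMeasure
  have hG : HasGaussianLaw (fun ω => (Z · ω)) P :=
    iIndepFun.hasGaussianLaw (fun k => (hl k).hasGaussianLaw) hZ
  have hmem : ∀ k, MemLp (Z k) 2 P := fun k => (hl k).hasGaussianLaw.memLp_two
  have hcovZ : ∀ k l, cov[Z k, Z l; P] = if k = l then 1 else 0 := by
    intro k l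
    split_ifs with h
    · subst h
      rw [covariance_self (hl k).aemeasurable, (hl k).variance_eq, variance_id_gaussianReal]
      simp
    · exact (hZ.indepFun h).covariance_eq_zero (hmem k) (hmem l)
  have hcov : ∀ i j, cov[fun ω => ∑ k, c i k * Z k ω, fun ω => ∑ k, c j k * Z k ω; P]
      = ∑ k, c i k * c j k := by
    intro i j
    rw [covariance_fun_sum_fun_sum (fun k => (hmem k).const_mul _)
      (fun k => (hmem k).const_mul _)]
    simp_rw [covariance_const_mul_left, covariance_const_mul_right, hcovZ]
    simp
  let L : (κ → ℝ) →L[ℝ] (ι → ℝ) :=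
    ContinuousLinearMap.pi fun i => ∑ k, c i k • ContinuousLinearMap.proj k
  have hX : HasGaussianLaw (fun ω i => ∑ k, c i k * Z k ω) P := by
    have h : (fun ω i => ∑ k, c i k * Z k ω) = fun ω => L (Z · ω) := by
      ext ω i
      simp [L]
    rw [h]
    exact hG.map_fun L
  refine ⟨hX.iIndepFun_of_covariance_eq_zero fun i j hij => (hcov i j).trans (hc i j hij),
    fun i => ⟨(hX.eval i).aemeasurable, ?_⟩⟩
  rw [(hX.eval i).map_eq_gaussianReal]
  congr 1
  · rw [integral_finsetSum _ fun k _ => (hl k).hasGaussianLaw.integrable.const_mul _]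
    refine Finset.sum_eq_zero fun k _ => ?_
    rw [integral_const_mul, (hl k).integral_eq, integral_id_gaussianReal, mul_zero]
  · rw [← covariance_self (hX.eval i).aemeasurable, hcov]
    simp_rw [pow_two]

lemma measure_le_sum_le_of_lintegral_exp_le {ι : Type*} [Fintype ι] {Y : ι → Ω → ℝ}
    (hY : iIndepFun Y P) (hm : ∀ i, Measurable (Y i)) {b t : ℝ}
    (hb : ∀ i, ∫⁻ ω, ENNReal.ofReal (Real.exp (Y i ω)) ∂P ≤ ENNReal.ofReal (Real.exp b)) :
    P {ω | t ≤ ∑ i, Y i ω} ≤ ENNReal.ofReal (Real.exp (Fintype.card ι * b - t)) := by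
  have h1 : ∫⁻ ω, ENNReal.ofReal (Real.exp (∑ i, Y i ω)) ∂P
      ≤ ENNReal.ofReal (Real.exp (Fintype.card ι * b)) := by
    have h := lintegral_prod_eq_prod_lintegral_of_indepFun Finset.univ
      (fun i ω => ENNReal.ofReal (Real.exp (Y i ω)))
      (hY.comp (fun _ y => ENNReal.ofReal (Real.exp y)) (fun _ => by fun_prop))
      (fun i => by fun_prop)
    have h2 : ∀ ω, ENNReal.ofReal (Real.exp (∑ i, Y i ω))
        = ∏ i, ENNReal.ofReal (Real.exp (Y i ω)) := fun ω => by
      rw [Real.exp_sum, ENNReal.ofReal_prod_of_nonneg fun i _ => (Real.exp_pos _).le]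
    simp_rw [h2]
    rw [h]
    refine (Finset.prod_le_prod' fun i _ => hb i).trans_eq ?_
    rw [Finset.prod_const, ← ENNReal.ofReal_pow (Real.exp_pos _).le, ← Real.exp_nat_mul]
    rfl
  have h3 := mul_meas_ge_le_lintegral₀ (μ := P)
    (f := fun ω => ENNReal.ofReal (Real.exp (∑ i, Y i ω))) (by fun_prop)
    (ENNReal.ofReal (Real.exp t))
  have h4 : {ω | ENNReal.ofReal (Real.exp t) ≤ ENNReal.ofReal (Real.exp (∑ i, Y i ω))}
      = {ω | t ≤ ∑ i, Y i ω} := by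
    ext ω
    simp [ENNReal.ofReal_le_ofReal_iff (Real.exp_pos _).le]
  rw [h4] at h3
  rw [sub_eq_add_neg, Real.exp_add, Real.exp_neg, ENNReal.ofReal_mul (Real.exp_pos _).le,
    ENNReal.ofReal_inv_of_pos (Real.exp_pos _), ← div_eq_mul_inv,
    ENNReal.le_div_iff_mul_le (by simp [Real.exp_pos]) (by simp), mul_comm]
  exact h3.trans h1

lemma lintegral_exp_sq_div_four_gaussianReal :
    ∫⁻ x, ENNReal.ofReal (Real.exp (x ^ 2 / 4)) ∂gaussianReal 0 1 = ENNReal.ofReal (√2) := by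
  rw [gaussianReal_of_var_ne_zero _ one_ne_zero,
    lintegral_withDensity_eq_lintegral_mul _ (measurable_gaussianPDF _ _) (by fun_prop)]
  have h : ∀ x : ℝ, (gaussianPDF 0 1 * fun x => ENNReal.ofReal (Real.exp (x ^ 2 / 4))) x
      = ENNReal.ofReal ((√(2 * Real.pi))⁻¹ * Real.exp (-(1 / 4) * x ^ 2)) := fun x => by
    rw [Pi.mul_apply, gaussianPDF_def, ← ENNReal.ofReal_mul (gaussianPDFReal_nonneg _ _ _),
      gaussianPDFReal_def, mul_assoc, ← Real.exp_add]
    congr 2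
    · simp
    · congr 1
      simp
      ring
  simp_rw [h]
  rw [← ofReal_integral_eq_lintegral_ofReal
      ((integrable_exp_neg_mul_sq (by norm_num)).const_mul _)
      (Filter.Eventually.of_forall fun x => by positivity),
    integral_const_mul, integral_gaussian, ← Real.sqrt_inv, ← Real.sqrt_mul (by positivity)]
  congr 2
  field_simp
  norm_num

lemma lintegral_exp_softThreshold_sq_gaussianReal (lam : ℝ) (hlam : 0 ≤ lam) :
    ∫⁻ x, ENNReal.ofReal (Real.exp ((max (|x| - lam) 0) ^ 2 / 4)) ∂gaussianReal 0 1
      ≤ ENNReal.ofReal (Real.exp (2 * Real.exp (-lam ^ 2 / 4))) := by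
  have hpt : ∀ x : ℝ, ENNReal.ofReal (Real.exp ((max (|x| - lam) 0) ^ 2 / 4))
      ≤ 1 + ENNReal.ofReal (Real.exp (-lam ^ 2 / 4)) * ENNReal.ofReal (Real.exp (x ^ 2 / 4)) := by
    intro x
    rw [← ENNReal.ofReal_mul (Real.exp_pos _).le, ← ENNReal.ofReal_one,
      ← ENNReal.ofReal_add zero_le_one (by positivity), ← Real.exp_add]
    refine ENNReal.ofReal_le_ofReal ?_
    rcases le_total (|x| - lam) 0 with h | h
    · rw [max_eq_right h]
      simp only [ne_eq, OfNat.ofNat_ne_zero, not_false_eq_true, zero_pow, zero_div, Real.exp_zero]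
      linarith [Real.exp_pos (-lam ^ 2 / 4 + x ^ 2 / 4)]
    · rw [max_eq_left h]
      have : (|x| - lam) ^ 2 / 4 ≤ -lam ^ 2 / 4 + x ^ 2 / 4 := by
        nlinarith [sq_abs x]
      linarith [Real.exp_le_exp.2 this]
  refine (lintegral_mono hpt).trans ?_
  rw [lintegral_add_left measurable_const, lintegral_const_mul _ (by fun_prop),
    lintegral_exp_sq_div_four_gaussianReal, lintegral_const, measure_univ, mul_one,
    ← ENNReal.ofReal_mul (Real.exp_pos _).le, ← ENNReal.ofReal_one,
    ← ENNReal.ofReal_add zero_le_one (by positivity)]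
  refine ENNReal.ofReal_le_ofReal ?_
  have h2 : √2 ≤ 2 := Real.sqrt_le_iff.2 (by norm_num)
  have h3 := mul_le_mul_of_nonneg_left h2 (Real.exp_pos (-lam ^ 2 / 4)).le
  linarith [Real.add_one_le_exp (2 * Real.exp (-lam ^ 2 / 4))]

lemma le_gaussianReal_Icc {a b : ℝ} (ha : -2 ≤ a) (hb : b ≤ 2) :
    ENNReal.ofReal (gaussianPDFReal 0 1 2 * (b - a)) ≤ gaussianReal 0 1 (Set.Icc a b) := by
  rw [gaussianReal_apply _ one_ne_zero, ENNReal.ofReal_mul (gaussianPDFReal_nonneg _ _ _),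
    ← Real.volume_Icc, ← setLIntegral_const]
  refine setLIntegral_mono (by fun_prop) fun x hx => ENNReal.ofReal_le_ofReal ?_
  rw [gaussianPDFReal_def]
  have : x ^ 2 ≤ 2 ^ 2 := by nlinarith [hx.1, hx.2]
  simp only [sub_zero]
  gcongr

lemma gaussianPDFReal_two_le_one : gaussianPDFReal 0 1 2 ≤ 1 := by
  rw [gaussianPDFReal_def]
  refine mul_le_one₀ (inv_le_one_of_one_le₀ (Real.one_le_sqrt.2 ?_)) (Real.exp_pos _).le
    (Real.exp_le_one_iff.2 ?_)
  · simp only [NNReal.coe_one, mul_one]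
    linarith [Real.pi_gt_three]
  · norm_num

end Gaussian

section Separation

/-- Twice the smaller of `|s|` and `|t|` when `s` and `t` have opposite signs, and `0` otherwise. -/
noncomputable def signGap (s t : ℝ) : ℝ := max (|s - t| - |s + t|) 0

lemma signGap_eq_zero {s t : ℝ} (h : 0 ≤ s * t) : signGap s t = 0 :=
  max_eq_right (sub_nonpos.2 (sq_le_sq.1 (by nlinarith)))

lemma signGap_le_add (s t s' t' : ℝ) :
    signGap s' t' ≤ signGap s t + 2 * |s - s'| + 2 * |t - t'| := by
  unfold signGap
  have h1 : |s' - t'| ≤ |s - t| + |s - s'| + |t - t'| := by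
    have h := abs_add_three (s - t) (-(s - s')) (t - t')
    rwa [abs_neg, show s - t + -(s - s') + (t - t') = s' - t' by ring] at h
  have h2 : |s + t| ≤ |s' + t'| + |s - s'| + |t - t'| := by
    have h := abs_add_three (s' + t') (s - s') (t - t')
    rwa [show s' + t' + (s - s') + (t - t') = s + t by ring] at h
  refine max_le ?_ ?_
  · linarith [le_max_left (|s - t| - |s + t|) 0]
  · linarith [le_max_right (|s - t| - |s + t|) 0, abs_nonneg (s - s'), abs_nonneg (t - t')]

variable {n : ℕ}

lemma measurable_dot_left (u : Fin n → ℝ) : Measurable fun a : Fin n → ℝ => dot a u := by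
  unfold dot
  fun_prop

lemma measurable_signGap_dot (u v : Fin n → ℝ) :
    Measurable fun a : Fin n → ℝ => signGap (dot a u) (dot a v) := by
  unfold signGap
  have := measurable_dot_left u
  have := measurable_dot_left v
  fun_prop

lemma iIndepFun_eval_pi_gaussianReal (ι : Type*) [Fintype ι] :
    iIndepFun (fun (j : ι) (a : ι → ℝ) => a j) (Measure.pi fun _ => gaussianReal 0 1) :=
  iIndepFun_pi (X := fun _ => id) fun _ => aemeasurable_id

lemma measure_preimage_of_hasLaw_gaussianReal {Ω : Type*} [MeasurableSpace Ω] {P : Measure Ω}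
    {X : Ω → ℝ} {v r : ℝ} (hX : HasLaw X (gaussianReal 0 v.toNNReal) P) (hv : v = r ^ 2)
    {B : Set ℝ} (hB : MeasurableSet B) :
    P (X ⁻¹' B) = gaussianReal 0 1 {g | r * g ∈ B} := by
  rw [← Measure.map_apply_of_aemeasurable hX.aemeasurable hB, hX.map_eq]
  have h : gaussianReal 0 v.toNNReal = (gaussianReal 0 1).map (r * ·) := by
    rw [gaussianReal_map_const_mul]
    congr 1
    · simp
    · ext
      simp [hv, sq_nonneg]
  rw [h, Measure.map_apply (by fun_prop) hB]
  rfl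

lemma le_measure_separated {u v : Fin n → ℝ} (hu : ∑ j, u j ^ 2 = 1) (hv : ∑ j, v j ^ 2 = 1)
    {δ : ℝ} (huv : δ ^ 2 / 4 ≤ ∑ j, (u j - v j) ^ 2) :
    ∃ E : Set (Fin n → ℝ), MeasurableSet E ∧
      ENNReal.ofReal (gaussianPDFReal 0 1 2 ^ 2 * δ / 4)
        ≤ Measure.pi (fun _ : Fin n => gaussianReal 0 1) E ∧
      ∀ a ∈ E, δ / 4 ≤ signGap (dot a u) (dot a v) := by
  set κ := gaussianPDFReal 0 1 2
  have hκ : 0 ≤ κ := gaussianPDFReal_nonneg _ _ _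
  set D := ∑ j, (u j - v j) ^ 2 with hD
  have hsum : D + ∑ j, (u j + v j) ^ 2 = 4 := by
    rw [hD, ← Finset.sum_add_distrib]
    have : ∀ j, (u j - v j) ^ 2 + (u j + v j) ^ 2 = 2 * u j ^ 2 + 2 * v j ^ 2 := fun j => by ring
    simp_rw [this]
    rw [Finset.sum_add_distrib, ← Finset.mul_sum, ← Finset.mul_sum, hu, hv]
    norm_num
  have hq0 : 0 ≤ ∑ j, (u j + v j) ^ 2 := Finset.sum_nonneg fun j _ => sq_nonneg _
  have hD0 : 0 ≤ D := Finset.sum_nonneg fun j _ => sq_nonneg _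
  set d := √D
  have hdD : D = d ^ 2 := (Real.sq_sqrt hD0).symm
  have hd0 : 0 ≤ d := Real.sqrt_nonneg _
  have hdδ : δ / 2 ≤ d := Real.le_sqrt_of_sq_le (by linarith)
  have hd2 : d ≤ 2 := Real.sqrt_le_iff.2 ⟨by norm_num, by linarith⟩
  have horth : ∑ j, (u j - v j) * (u j + v j) = 0 := by
    have : ∀ j, (u j - v j) * (u j + v j) = u j ^ 2 - v j ^ 2 := fun j => by ring
    simp_rw [this]
    rw [Finset.sum_sub_distrib, hu, hv, sub_self]
  let c : Fin 2 → Fin n → ℝ := ![fun j => u j - v j, fun j => u j + v j]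
  obtain ⟨hI, hL⟩ := iIndepFun_hasLaw_linearCombination
    (iIndepFun_eval_pi_gaussianReal (Fin n))
    (fun j => (measurePreserving_eval (fun _ : Fin n => gaussianReal 0 1) j).hasLaw) c
    (fun i j hij => by
      fin_cases i <;> fin_cases j <;> simp [c] at hij ⊢
      · exact horth
      · simpa only [mul_comm] using horth)
  have hL0 := hL 0
  have hL1 := hL 1
  have hI01 := hI.indepFun (show (0 : Fin 2) ≠ 1 by decide)
  simp only [c, Matrix.cons_val_zero, Matrix.cons_val_one] at hL0 hL1 hI01
  set X : (Fin n → ℝ) → ℝ := fun a => ∑ j, (u j - v j) * a j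
  set Y : (Fin n → ℝ) → ℝ := fun a => ∑ j, (u j + v j) * a j
  have hXm : Measurable X := by fun_prop
  have hYm : Measurable Y := by fun_prop
  have hA : MeasurableSet {y : ℝ | d ≤ |y|} := measurableSet_le measurable_const (by fun_prop)
  have hB : MeasurableSet {y : ℝ | |y| ≤ d / 2} := measurableSet_le (by fun_prop) measurable_const
  refine ⟨X ⁻¹' {y | d ≤ |y|} ∩ Y ⁻¹' {y | |y| ≤ d / 2}, (hXm hA).inter (hYm hB), ?_, ?_⟩
  · rw [hI01.measure_inter_preimage_eq_mul _ _ hA hB,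
      measure_preimage_of_hasLaw_gaussianReal hL0 hdD hA,
      measure_preimage_of_hasLaw_gaussianReal hL1 (Real.sq_sqrt hq0).symm hB]
    have h1 : ENNReal.ofReal (κ * (2 - 1)) ≤ gaussianReal 0 1 {g | d * g ∈ {y : ℝ | d ≤ |y|}} := by
      refine (le_gaussianReal_Icc (by norm_num) le_rfl).trans (measure_mono fun g hg => ?_)
      simp only [Set.mem_ofPred_eq, abs_mul, abs_of_nonneg hd0]
      exact le_mul_of_one_le_right hd0 (hg.1.trans (le_abs_self g))
    have h2 : ENNReal.ofReal (κ * (d / 4 - -(d / 4)))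
        ≤ gaussianReal 0 1 {g | √(∑ j, (u j + v j) ^ 2) * g ∈ {y : ℝ | |y| ≤ d / 2}} := by
      refine (le_gaussianReal_Icc (by linarith) (by linarith)).trans (measure_mono fun g hg => ?_)
      simp only [Set.mem_ofPred_eq, abs_mul, abs_of_nonneg (Real.sqrt_nonneg _)]
      have hs : √(∑ j, (u j + v j) ^ 2) ≤ 2 := Real.sqrt_le_iff.2 ⟨by norm_num, by linarith⟩
      calc _ ≤ 2 * (d / 4) := mul_le_mul hs (abs_le.2 hg) (abs_nonneg g) (by norm_num)
        _ = d / 2 := by ring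
    refine le_trans ?_ (mul_le_mul' h1 h2)
    rw [← ENNReal.ofReal_mul (by linarith)]
    refine ENNReal.ofReal_le_ofReal ?_
    have := mul_le_mul_of_nonneg_left hdδ (sq_nonneg κ)
    linarith
  · rintro a ⟨ha1, ha2⟩
    have hX : X a = dot a u - dot a v := by
      simp only [X, dot, ← Finset.sum_sub_distrib]
      exact Finset.sum_congr rfl fun j _ => by ring
    have hY : Y a = dot a u + dot a v := by
      simp only [Y, dot, ← Finset.sum_add_distrib]
      exact Finset.sum_congr rfl fun j _ => by ring
    simp only [Set.mem_preimage, Set.mem_ofPred_eq, hX, hY] at ha1 ha2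
    refine le_max_of_le_left ?_
    linarith

lemma lintegral_exp_neg_signGap_le {u v : Fin n → ℝ} (hu : ∑ j, u j ^ 2 = 1)
    (hv : ∑ j, v j ^ 2 = 1) {δ : ℝ} (hδ : 0 < δ) (huv : δ ^ 2 / 4 ≤ ∑ j, (u j - v j) ^ 2) :
    ∫⁻ a, ENNReal.ofReal (Real.exp (-(4 / δ) * signGap (dot a u) (dot a v)))
        ∂Measure.pi (fun _ : Fin n => gaussianReal 0 1)
      ≤ ENNReal.ofReal (Real.exp (-(gaussianPDFReal 0 1 2 ^ 2 * δ / 8))) := by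
  obtain ⟨E, hE, hEμ, hEgap⟩ := le_measure_separated hu hv huv
  set μ := Measure.pi (fun _ : Fin n => gaussianReal 0 1)
  set κ := gaussianPDFReal 0 1 2
  set F : (Fin n → ℝ) → ℝ≥0∞ := fun a =>
    ENNReal.ofReal (Real.exp (-(4 / δ) * signGap (dot a u) (dot a v)))
  have hFm : Measurable F := by
    have := measurable_signGap_dot u v
    fun_prop
  have hpt : ∀ a, F a + E.indicator (fun _ => ENNReal.ofReal (1 / 2)) a ≤ 1 := by
    intro a
    by_cases ha : a ∈ E
    · rw [Set.indicator_of_mem ha, ← ENNReal.ofReal_add (Real.exp_pos _).le (by norm_num),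
        ← ENNReal.ofReal_one]
      refine ENNReal.ofReal_le_ofReal ?_
      have h1 : -(4 / δ) * signGap (dot a u) (dot a v) ≤ -1 := by
        have := mul_le_mul_of_nonneg_left (hEgap a ha) (show 0 ≤ 4 / δ by positivity)
        have h4 : 4 / δ * (δ / 4) = 1 := by field_simp
        linarith
      have h2 : Real.exp (-1) ≤ 1 / 2 := by
        rw [Real.exp_neg, one_div]
        exact inv_anti₀ two_pos (by linarith [Real.add_one_le_exp 1])
      linarith [Real.exp_le_exp.2 h1]
    · rw [Set.indicator_of_notMem ha, add_zero, ← ENNReal.ofReal_one]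
      refine ENNReal.ofReal_le_ofReal (Real.exp_le_one_iff.2 ?_)
      rw [neg_mul, neg_nonpos]
      exact mul_nonneg (by positivity) (le_max_right _ _)
  have hint : ∫⁻ a, F a ∂μ + ENNReal.ofReal (1 / 2) * μ E ≤ 1 := by
    rw [← lintegral_indicator_const hE, ← lintegral_add_left hFm]
    exact (lintegral_mono hpt).trans (by simp)
  have hmul : ENNReal.ofReal (κ ^ 2 * δ / 8) ≤ ENNReal.ofReal (1 / 2) * μ E := by
    refine le_trans ?_ (mul_le_mul_right hEμ _)
    rw [← ENNReal.ofReal_mul (by norm_num)]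
    exact ENNReal.ofReal_le_ofReal (by linarith)
  have hle : ∫⁻ a, F a ∂μ ≤ 1 - ENNReal.ofReal (κ ^ 2 * δ / 8) :=
    ENNReal.le_sub_of_add_le_right ENNReal.ofReal_ne_top
      ((add_le_add_right hmul _).trans hint)
  refine hle.trans ?_
  rw [← ENNReal.ofReal_one, ← ENNReal.ofReal_sub _ (by positivity)]
  refine ENNReal.ofReal_le_ofReal ?_
  linarith [Real.add_one_le_exp (-(κ ^ 2 * δ / 8))]

lemma measure_sum_signGap_le {m : ℕ} {u v : Fin n → ℝ} (hu : ∑ j, u j ^ 2 = 1)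
    (hv : ∑ j, v j ^ 2 = 1) {δ : ℝ} (hδ : 0 < δ) (huv : δ ^ 2 / 4 ≤ ∑ j, (u j - v j) ^ 2) :
    stdGaussianVectors m n {a | ∑ i, signGap (dot (a i) u) (dot (a i) v)
        ≤ gaussianPDFReal 0 1 2 ^ 2 / 64 * δ ^ 2 * m}
      ≤ ENNReal.ofReal (Real.exp (-(gaussianPDFReal 0 1 2 ^ 2 / 16 * δ * m))) := by
  set κ := gaussianPDFReal 0 1 2
  have hgm := measurable_signGap_dot u v
  have h := measure_le_sum_le_of_lintegral_exp_le (P := stdGaussianVectors m n)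
    (Y := fun (i : Fin m) a => -(4 / δ) * signGap (dot (a i) u) (dot (a i) v))
    (b := -(κ ^ 2 * δ / 8)) (t := -(κ ^ 2 / 16 * δ * m))
    (iIndepFun_pi (X := fun _ a => -(4 / δ) * signGap (dot a u) (dot a v))
      fun _ => (hgm.const_mul _).aemeasurable)
    (fun i => (hgm.comp (measurable_pi_apply i)).const_mul _)
    (fun i => by
      rw [stdGaussianVectors]
      rw [(measurePreserving_eval (fun _ : Fin m =>
        Measure.pi fun _ : Fin n => gaussianReal 0 1) i).lintegral_comp
        (f := fun a => ENNReal.ofReal (Real.exp (-(4 / δ) * signGap (dot a u) (dot a v))))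
        (by fun_prop)]
      exact lintegral_exp_neg_signGap_le hu hv hδ huv)
  refine (measure_mono fun a ha => ?_).trans (h.trans_eq ?_)
  · simp only [Set.mem_ofPred_eq, ← Finset.mul_sum] at ha ⊢
    have := mul_le_mul_of_nonneg_left ha (show 0 ≤ 4 / δ by positivity)
    have h4 : 4 / δ * (κ ^ 2 / 64 * δ ^ 2 * m) = κ ^ 2 / 16 * δ * m := by
      field_simp
      ring
    linarith
  · rw [Fintype.card_fin]
    congr 2
    ring

end Separation

section UniformBound

variable {m n : ℕ}

instance isProbabilityMeasure_stdGaussianVectors :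
    IsProbabilityMeasure (stdGaussianVectors m n) := by
  unfold stdGaussianVectors
  infer_instance

lemma measure_softThreshold_le (hm : 0 < m) {σ : Fin m → ℝ} (hσ : ∀ i, σ i ^ 2 = 1)
    {lam : ℝ} (hlam : 0 ≤ lam) :
    stdGaussianVectors m n
        {a | 16 * m ≤ ∑ j, max (|∑ i, σ i / √m * a i j| - lam) 0 ^ 2}
      ≤ ENNReal.ofReal (Real.exp (n * (2 * Real.exp (-lam ^ 2 / 4)) - 4 * m)) := by
  classical
  have hm0 : (0 : ℝ) < m := by exact_mod_cast hm
  have hl : ∀ p : Fin m × Fin n, HasLaw (fun a : Fin m → Fin n → ℝ => a p.1 p.2)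
      (gaussianReal 0 1) (stdGaussianVectors m n) := fun p =>
    ((measurePreserving_eval (fun _ : Fin n => gaussianReal 0 1) p.2).comp
      (measurePreserving_eval (fun _ : Fin m =>
        Measure.pi fun _ : Fin n => gaussianReal 0 1) p.1)).hasLaw
  have hZ : iIndepFun (fun (p : Fin m × Fin n) (a : Fin m → Fin n → ℝ) => a p.1 p.2)
      (stdGaussianVectors m n) := by
    refine iIndepFun_uncurry' (X := fun i j (a : Fin m → Fin n → ℝ) => a i j)
      (fun i j => by fun_prop) (iIndepFun_pi (X := fun _ => id) fun _ => aemeasurable_id)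
      fun i => ?_
    rw [iIndepFun_iff_map_fun_eq_pi_map fun j => (hl (i, j)).aemeasurable]
    refine ((measurePreserving_eval (fun _ : Fin m =>
      Measure.pi fun _ : Fin n => gaussianReal 0 1) i).map_eq).trans ?_
    congr 1
    ext1 j
    exact (hl (i, j)).map_eq.symm
  let c : Fin n → Fin m × Fin n → ℝ := fun j p => if p.2 = j then σ p.1 / √m else 0
  obtain ⟨hI, hL⟩ := iIndepFun_hasLaw_linearCombination hZ hl c fun i j hij =>
    Finset.sum_eq_zero fun p _ => by
      by_cases h : p.2 = i
      · have : p.2 ≠ j := h ▸ hij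
        simp [c, this]
      · simp [c, h]
  have hX : ∀ j (a : Fin m → Fin n → ℝ), ∑ p, c j p * a p.1 p.2 = ∑ i, σ i / √m * a i j := by
    intro j a
    simp [c, Fintype.sum_prod_type, ite_mul]
  have hvar : ∀ j, ∑ p, c j p ^ 2 = 1 := by
    intro j
    simp [c, Fintype.sum_prod_type, ite_pow, div_pow, hσ, hm0.ne']
  simp_rw [hX] at hI hL
  simp_rw [hvar, Real.toNNReal_one] at hL
  have hφ : Measurable fun x : ℝ => max (|x| - lam) 0 ^ 2 / 4 := by fun_prop
  have h := measure_le_sum_le_of_lintegral_exp_le (P := stdGaussianVectors m n)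
    (Y := fun j a => max (|∑ i, σ i / √m * a i j| - lam) 0 ^ 2 / 4)
    (b := 2 * Real.exp (-lam ^ 2 / 4)) (t := 4 * m)
    (hI.comp _ fun _ => hφ) (fun j => by fun_prop)
    (fun j => by
      have := lintegral_exp_softThreshold_sq_gaussianReal lam hlam
      rwa [← (hL j).map_eq, lintegral_map (by fun_prop) (by fun_prop)] at this)
  refine (measure_mono fun a ha => ?_).trans (h.trans_eq ?_)
  · simp only [Set.mem_ofPred_eq, ← Finset.sum_div] at ha ⊢
    linarith
  · rw [Fintype.card_fin]

lemma sum_mul_le_softThreshold (g z : Fin n → ℝ) (lam : ℝ) :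
    ∑ j, g j * z j
      ≤ lam * ∑ j, |z j| + √(∑ j, max (|g j| - lam) 0 ^ 2) * √(∑ j, z j ^ 2) := by
  calc ∑ j, g j * z j ≤ ∑ j, (lam * |z j| + max (|g j| - lam) 0 * |z j|) :=
        Finset.sum_le_sum fun j _ => by
          rw [← add_mul]
          refine (le_abs_self _).trans ?_
          rw [abs_mul]
          gcongr
          linarith [le_max_left (|g j| - lam) 0]
    _ = lam * ∑ j, |z j| + ∑ j, max (|g j| - lam) 0 * |z j| := by
        rw [Finset.sum_add_distrib, Finset.mul_sum]
    _ ≤ _ := by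
        gcongr
        simpa only [sq_abs] using Real.sum_mul_le_sqrt_mul_sqrt Finset.univ
          (fun j => max (|g j| - lam) 0) (fun j => |z j|)

lemma sum_abs_dot_le (hm : 0 < m) {a : Fin m → Fin n → ℝ} {lam A ε : ℝ} (hlam : 0 ≤ lam)
    (hε : 0 ≤ ε) (hlamA : lam * A ≤ ε * √m)
    (ha : ∀ σ : Fin m → Bool,
      ∑ j, max (|∑ i, (if σ i then 1 else -1) / √m * a i j| - lam) 0 ^ 2 ≤ 16 * m)
    {z : Fin n → ℝ} (hz1 : ∑ j, |z j| ≤ A) (hz2 : ∑ j, z j ^ 2 ≤ ε ^ 2) :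
    ∑ i, |dot (a i) z| ≤ 5 * ε * m := by
  classical
  have hm0 : (0 : ℝ) < m := by exact_mod_cast hm
  have hsm : 0 < √(m : ℝ) := Real.sqrt_pos.2 hm0
  let σ : Fin m → Bool := fun i => decide (0 ≤ dot (a i) z)
  have hσ : ∀ i, |dot (a i) z| = (if σ i then 1 else -1) * dot (a i) z := by
    intro i
    by_cases h : 0 ≤ dot (a i) z
    · simp [σ, h]
    · simp [σ, h, abs_of_neg (not_le.1 h)]
  have hsum : ∑ i, |dot (a i) z|
      = √m * ∑ j, (∑ i, (if σ i then 1 else -1) / √m * a i j) * z j := by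
    simp_rw [hσ, dot, Finset.mul_sum, Finset.sum_mul, Finset.mul_sum]
    rw [Finset.sum_comm]
    refine Finset.sum_congr rfl fun j _ => Finset.sum_congr rfl fun i _ => ?_
    field_simp
  have h1 := sum_mul_le_softThreshold
    (fun j => ∑ i, (if σ i then 1 else -1) / √m * a i j) z lam
  have h2 : √(∑ j, max (|∑ i, (if σ i then 1 else -1) / √m * a i j| - lam) 0 ^ 2) ≤ 4 * √m :=
    Real.sqrt_le_iff.2 ⟨by positivity, by
      rw [mul_pow, Real.sq_sqrt hm0.le]
      linarith [ha σ]⟩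
  have h3 : √(∑ j, z j ^ 2) ≤ ε := Real.sqrt_le_iff.2 ⟨hε, hz2⟩
  rw [hsum]
  calc _ ≤ √m * (ε * √m + 4 * √m * ε) := by
        gcongr
        refine h1.trans (add_le_add ?_ ?_)
        · exact (mul_le_mul_of_nonneg_left hz1 hlam).trans hlamA
        · exact mul_le_mul h2 h3 (Real.sqrt_nonneg _) (by positivity)
    _ = 5 * ε * (√m * √m) := by ring
    _ = 5 * ε * m := by rw [Real.mul_self_sqrt hm0.le]

end UniformBound

section Net

variable {n : ℕ}

lemma sum_pow_natAbs_le (S : Finset ℤ) {r : ℝ} (hr : 0 < r) (hr2 : r ≤ 1 / 2) :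
    ∑ k ∈ S, r ^ k.natAbs ≤ Real.exp (4 * r) := by
  have h1 : HasSum (fun k : ℕ => r ^ ((k : ℤ)).natAbs) (1 - r)⁻¹ := by
    simpa using hasSum_geometric_of_lt_one hr.le (by linarith)
  have h2 : HasSum (fun k : ℕ => r ^ (-(k + 1 : ℤ)).natAbs) (r * (1 - r)⁻¹) := by
    have h := (hasSum_geometric_of_lt_one hr.le (by linarith)).mul_left r
    have hk : ∀ k : ℕ, r ^ (-(k + 1 : ℤ)).natAbs = r * r ^ k := fun k => by
      rw [Int.natAbs_neg, ← pow_succ', ← Nat.cast_succ, Int.natAbs_natCast]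
    simpa only [hk] using h
  have h3 := HasSum.of_nat_of_neg_add_one (f := fun k : ℤ => r ^ k.natAbs) h1 h2
  refine (sum_le_hasSum S (fun k _ => by positivity) h3).trans ?_
  have h4 : (1 - r)⁻¹ + r * (1 - r)⁻¹ ≤ 4 * r + 1 := by
    have : (1 - r)⁻¹ + r * (1 - r)⁻¹ = (1 + r) / (1 - r) := by
      field_simp
    rw [this, div_le_iff₀ (by linarith)]
    nlinarith
  exact h4.trans (Real.add_one_le_exp _)

lemma card_integer_l1Ball_le (W : Finset (Fin n → ℤ)) {T r : ℝ} (hr : 0 < r) (hr2 : r ≤ 1 / 2)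
    (hW : ∀ w ∈ W, ∑ j, |(w j : ℝ)| ≤ T) :
    (W.card : ℝ) ≤ Real.exp (T * Real.log (1 / r) + 4 * r * n) := by
  classical
  let S : Fin n → Finset ℤ := fun j => W.image fun w => w j
  have hS : W ⊆ Fintype.piFinset S := fun w hw =>
    Fintype.mem_piFinset.2 fun j => Finset.mem_image_of_mem _ hw
  have hpt : ∀ w ∈ W, (1 : ℝ) ≤ Real.exp (T * Real.log (1 / r)) * ∏ j, r ^ (w j).natAbs := by
    intro w hw
    have h1 : ∏ j, r ^ (w j).natAbs = Real.exp (-((∑ j, |(w j : ℝ)|) * Real.log (1 / r))) := by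
      rw [Finset.prod_pow_eq_pow_sum, ← Real.exp_log (pow_pos hr _), Real.log_pow, one_div,
        Real.log_inv]
      push_cast [Nat.cast_natAbs]
      congr 1
      ring
    rw [h1, ← Real.exp_add]
    refine Real.one_le_exp ?_
    have hl : 0 ≤ Real.log (1 / r) := Real.log_nonneg (by rw [le_div_iff₀ hr]; linarith)
    nlinarith [mul_le_mul_of_nonneg_right (hW w hw) hl]
  calc (W.card : ℝ) = ∑ w ∈ W, (1 : ℝ) := by simp
    _ ≤ ∑ w ∈ W, Real.exp (T * Real.log (1 / r)) * ∏ j, r ^ (w j).natAbs := Finset.sum_le_sum hpt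
    _ ≤ ∑ w ∈ Fintype.piFinset S, Real.exp (T * Real.log (1 / r)) * ∏ j, r ^ (w j).natAbs :=
        Finset.sum_le_sum_of_subset_of_nonneg hS fun w _ _ => by positivity
    _ = Real.exp (T * Real.log (1 / r)) * ∏ j, ∑ k ∈ S j, r ^ k.natAbs := by
        rw [← Finset.mul_sum, Finset.prod_univ_sum]
    _ ≤ Real.exp (T * Real.log (1 / r)) * ∏ _j : Fin n, Real.exp (4 * r) := by
        gcongr with j
        exact sum_pow_natAbs_le (S j) hr hr2
    _ = Real.exp (T * Real.log (1 / r) + 4 * r * n) := by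
        rw [Real.exp_add, Finset.prod_const, Finset.card_univ, Fintype.card_fin, ← Real.exp_nat_mul]
        ring_nf

lemma abs_round_le (t : ℝ) : |(round t : ℝ)| ≤ 2 * |t| := by
  by_cases h : |t| < 1 / 2
  · have : round t = 0 := by
      rw [round_eq_zero_iff]
      exact ⟨by linarith [neg_abs_le t], by linarith [le_abs_self t]⟩
    simp [this]
  · have h1 := abs_sub_round t
    have h2 := abs_sub_abs_le_abs_sub (round t : ℝ) t
    rw [abs_sub_comm] at h2
    linarith

lemma exists_net (p : (Fin n → ℝ) → Prop) {R η r : ℝ} (hη : 0 < η) (hr : 0 < r)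
    (hr2 : r ≤ 1 / 2) :
    ∃ N : Finset (Fin n → ℝ), (∀ u ∈ N, p u ∧ ∑ j, |u j| ≤ R) ∧
      (N.card : ℝ) ≤ Real.exp (2 * R / η * Real.log (1 / r) + 4 * r * n) ∧
      ∀ x, p x → ∑ j, |x j| ≤ R → ∃ u ∈ N, ∑ j, (x j - u j) ^ 2 ≤ 2 * η * R := by
  classical
  let w : (Fin n → ℝ) → Fin n → ℤ := fun x j => round (x j / η)
  let K : Set (Fin n → ℝ) := {x | p x ∧ ∑ j, |x j| ≤ R}
  have hw : ∀ x ∈ K, ∑ j, |(w x j : ℝ)| ≤ 2 * R / η := fun x hx => by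
    calc ∑ j, |(w x j : ℝ)| ≤ ∑ j, 2 / η * |x j| := Finset.sum_le_sum fun j _ => by
          refine (abs_round_le _).trans_eq ?_
          rw [abs_div, abs_of_pos hη]
          ring
      _ = 2 / η * ∑ j, |x j| := by rw [Finset.mul_sum]
      _ ≤ 2 / η * R := by gcongr; exact hx.2
      _ = 2 * R / η := by ring
  have hfin : (w '' K).Finite := by
    refine (Set.Finite.pi' (t := fun _ : Fin n => Set.Icc (-⌈2 * R / η⌉) ⌈2 * R / η⌉)
      fun _ => Set.finite_Icc _ _).subset ?_
    rintro _ ⟨x, hx, rfl⟩ j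
    have h : |(w x j : ℝ)| ≤ ⌈2 * R / η⌉ :=
      ((Finset.single_le_sum (f := fun j => |(w x j : ℝ)|) (fun j _ => abs_nonneg _)
        (Finset.mem_univ j)).trans (hw x hx)).trans (Int.le_ceil _)
    exact abs_le.1 (by exact_mod_cast h)
  have hsel : ∀ k ∈ hfin.toFinset, ∃ x ∈ K, w x = k := fun k hk => hfin.mem_toFinset.1 hk
  choose! f hfK hfw using hsel
  refine ⟨hfin.toFinset.image f, ?_, ?_, ?_⟩
  · intro u hu
    obtain ⟨k, hk, rfl⟩ := Finset.mem_image.1 hu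
    exact hfK k hk
  · refine le_trans (by exact_mod_cast Finset.card_image_le)
      (card_integer_l1Ball_le hfin.toFinset hr hr2 fun k hk => ?_)
    rw [← hfw k hk]
    exact hw _ (hfK k hk)
  · intro x hx hxR
    have hk : w x ∈ hfin.toFinset := hfin.mem_toFinset.2 ⟨x, ⟨hx, hxR⟩, rfl⟩
    refine ⟨f (w x), Finset.mem_image_of_mem _ hk, ?_⟩
    have hxu : ∀ j, |x j - f (w x) j| ≤ η := by
      intro j
      have h1 := abs_sub_round (x j / η)
      have h2 := abs_sub_round (f (w x) j / η)
      have h3 : round (f (w x) j / η) = round (x j / η) := congrFun (hfw _ hk) j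
      rw [h3] at h2
      have h4 := abs_sub_le (x j / η) (round (x j / η)) (f (w x) j / η)
      rw [abs_sub_comm (round _ : ℝ), ← sub_div, abs_div, abs_of_pos hη] at h4
      exact (div_le_one hη).1 (by linarith)
    calc ∑ j, (x j - f (w x) j) ^ 2 ≤ ∑ j, η * (|x j| + |f (w x) j|) :=
          Finset.sum_le_sum fun j _ => by
            rw [← sq_abs, sq]
            exact mul_le_mul (hxu j) (abs_sub _ _) (abs_nonneg _) hη.le
      _ = η * (∑ j, |x j| + ∑ j, |f (w x) j|) := by
          rw [← Finset.mul_sum, Finset.sum_add_distrib]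
      _ ≤ η * (R + R) := by gcongr; exact (hfK _ hk).2
      _ = 2 * η * R := by ring

end Net

section Tessellation

variable {n m : ℕ}

lemma measure_exists_sum_signGap_le (N : Finset (Fin n → ℝ)) (hN : ∀ u ∈ N, ∑ j, u j ^ 2 = 1)
    {δ : ℝ} (hδ : 0 < δ) :
    stdGaussianVectors m n {a | ∃ u ∈ N, ∃ v ∈ N, δ ^ 2 / 4 ≤ ∑ j, (u j - v j) ^ 2 ∧
        ∑ i, signGap (dot (a i) u) (dot (a i) v) ≤ gaussianPDFReal 0 1 2 ^ 2 / 64 * δ ^ 2 * m}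
      ≤ ENNReal.ofReal
          ((N.card : ℝ) ^ 2 * Real.exp (-(gaussianPDFReal 0 1 2 ^ 2 / 16 * δ * m))) := by
  classical
  set κ := gaussianPDFReal 0 1 2
  let F := (N ×ˢ N).filter fun p => δ ^ 2 / 4 ≤ ∑ j, (p.1 j - p.2 j) ^ 2
  let B : (Fin n → ℝ) × (Fin n → ℝ) → Set (Fin m → Fin n → ℝ) := fun p =>
    {a | ∑ i, signGap (dot (a i) p.1) (dot (a i) p.2) ≤ κ ^ 2 / 64 * δ ^ 2 * m}
  have hcard : (F.card : ℝ) ≤ (N.card : ℝ) ^ 2 := by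
    have : F.card ≤ N.card * N.card :=
      (Finset.card_filter_le _ _).trans_eq (Finset.card_product _ _)
    rw [sq]
    exact_mod_cast this
  calc _ ≤ stdGaussianVectors m n (⋃ p ∈ F, B p) := by
        refine measure_mono ?_
        rintro a ⟨u, hu, v, hv, huv, h⟩
        exact Set.mem_biUnion (x := (u, v))
          (Finset.mem_filter.2 ⟨Finset.mem_product.2 ⟨hu, hv⟩, huv⟩) h
    _ ≤ ∑ p ∈ F, stdGaussianVectors m n (B p) := measure_biUnion_finset_le _ _
    _ ≤ ∑ _p ∈ F, ENNReal.ofReal (Real.exp (-(κ ^ 2 / 16 * δ * m))) := by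
        refine Finset.sum_le_sum fun p hp => ?_
        obtain ⟨hp1, hp2⟩ := Finset.mem_filter.1 hp
        obtain ⟨hu, hv⟩ := Finset.mem_product.1 hp1
        exact measure_sum_signGap_le (hN _ hu) (hN _ hv) hδ hp2
    _ = ENNReal.ofReal (F.card * Real.exp (-(κ ^ 2 / 16 * δ * m))) := by
        rw [Finset.sum_const, nsmul_eq_mul, ENNReal.ofReal_mul (by positivity),
          ENNReal.ofReal_natCast]
    _ ≤ _ := by gcongr

lemma measure_exists_softThreshold_le (hm : 0 < m) {lam : ℝ} (hlam : 0 ≤ lam) :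
    stdGaussianVectors m n {a | ∃ σ : Fin m → Bool,
        16 * m ≤ ∑ j, max (|∑ i, (if σ i then 1 else -1) / √m * a i j| - lam) 0 ^ 2}
      ≤ ENNReal.ofReal (2 ^ m * Real.exp (n * (2 * Real.exp (-lam ^ 2 / 4)) - 4 * m)) := by
  set b := Real.exp (n * (2 * Real.exp (-lam ^ 2 / 4)) - 4 * m)
  rw [Set.ofPred_exists]
  calc _ ≤ ∑ _σ : Fin m → Bool, ENNReal.ofReal b :=
        (measure_iUnion_fintype_le _ _).trans <| Finset.sum_le_sum fun σ _ =>
          measure_softThreshold_le hm (fun i => by split_ifs <;> norm_num) hlam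
    _ = ENNReal.ofReal (2 ^ m * b) := by
        rw [Finset.sum_const, nsmul_eq_mul, ENNReal.ofReal_mul (by positivity),
          ENNReal.ofReal_pow (by norm_num)]
        simp

lemma l2norm_sub_le (x y z : Fin n → ℝ) :
    √(∑ j, (x j - z j) ^ 2) ≤ √(∑ j, (x j - y j) ^ 2) + √(∑ j, (y j - z j) ^ 2) := by
  simpa [EuclideanSpace.dist_eq, Real.dist_eq] using
    dist_triangle (WithLp.toLp 2 x) (WithLp.toLp 2 y) (WithLp.toLp 2 z)

lemma dot_sub (a x y : Fin n → ℝ) : dot a x - dot a y = dot a (fun j => x j - y j) := by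
  simp only [dot, mul_sub, Finset.sum_sub_distrib]

lemma sum_signGap_dot_le {ε A : ℝ} {a : Fin m → Fin n → ℝ}
    (ha : ∀ z : Fin n → ℝ, ∑ j, |z j| ≤ A → ∑ j, z j ^ 2 ≤ ε ^ 2 → ∑ i, |dot (a i) z| ≤ 5 * ε * m)
    {x y u v : Fin n → ℝ} (hxu : ∑ j, |x j - u j| ≤ A) (hyv : ∑ j, |y j - v j| ≤ A)
    (hxu2 : ∑ j, (x j - u j) ^ 2 ≤ ε ^ 2) (hyv2 : ∑ j, (y j - v j) ^ 2 ≤ ε ^ 2)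
    (hsign : ∀ i, 0 ≤ dot (a i) x * dot (a i) y) :
    ∑ i, signGap (dot (a i) u) (dot (a i) v) ≤ 20 * ε * m := by
  calc ∑ i, signGap (dot (a i) u) (dot (a i) v)
      ≤ ∑ i, (2 * |dot (a i) fun j => x j - u j| + 2 * |dot (a i) fun j => y j - v j|) :=
        Finset.sum_le_sum fun i _ => by
          have h := signGap_le_add (dot (a i) x) (dot (a i) y) (dot (a i) u) (dot (a i) v)
          rwa [signGap_eq_zero (hsign i), dot_sub, dot_sub, zero_add] at h
    _ = 2 * ∑ i, |dot (a i) fun j => x j - u j| + 2 * ∑ i, |dot (a i) fun j => y j - v j| := by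
        rw [Finset.sum_add_distrib, Finset.mul_sum, Finset.mul_sum]
    _ ≤ 20 * ε * m := by linarith [ha _ hxu hxu2, ha _ hyv hyv2]

lemma sum_abs_sub_le {x u : Fin n → ℝ} {R : ℝ} (hx : ∑ j, |x j| ≤ R) (hu : ∑ j, |u j| ≤ R) :
    ∑ j, |x j - u j| ≤ 2 * R := by
  have h : ∑ j, |x j - u j| ≤ ∑ j, (|x j| + |u j|) := Finset.sum_le_sum fun j _ => abs_sub _ _
  rw [Finset.sum_add_distrib] at h
  linarith

lemma l2norm_le_of_net {N : Finset (Fin n → ℝ)} {R ε δ : ℝ} (hε : 0 ≤ ε) (hεδ : 4 * ε ≤ δ)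
    {a : Fin m → Fin n → ℝ} (hN1 : ∀ u ∈ N, ∑ j, |u j| ≤ R)
    (hnet : ∀ x : Fin n → ℝ, ∑ j, x j ^ 2 = 1 → ∑ j, |x j| ≤ R → ∃ u ∈ N, ∑ j, (x j - u j) ^ 2 ≤ ε ^ 2)
    (ha : ∀ z : Fin n → ℝ, ∑ j, |z j| ≤ 2 * R → ∑ j, z j ^ 2 ≤ ε ^ 2 →
      ∑ i, |dot (a i) z| ≤ 5 * ε * m)
    (hsep : ∀ u ∈ N, ∀ v ∈ N, δ ^ 2 / 4 ≤ ∑ j, (u j - v j) ^ 2 →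
      20 * ε * m < ∑ i, signGap (dot (a i) u) (dot (a i) v))
    {x y : Fin n → ℝ} (hx : ∑ j, x j ^ 2 = 1) (hy : ∑ j, y j ^ 2 = 1)
    (hxR : ∑ j, |x j| ≤ R) (hyR : ∑ j, |y j| ≤ R)
    (hsign : ∀ i, 0 ≤ dot (a i) x * dot (a i) y) : l2norm (x - y) ≤ δ := by
  obtain ⟨u, hu, hxu⟩ := hnet x hx hxR
  obtain ⟨v, hv, hyv⟩ := hnet y hy hyR
  by_contra! hlt
  simp only [l2norm, Pi.sub_apply] at hlt
  have hgap := sum_signGap_dot_le ha (sum_abs_sub_le hxR (hN1 u hu)) (sum_abs_sub_le hyR (hN1 v hv))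
    hxu hyv hsign
  refine (hsep u hu v hv ?_).not_ge hgap
  have h1 := l2norm_sub_le x u y
  have h2 := l2norm_sub_le u v y
  have h3 : √(∑ j, (x j - u j) ^ 2) ≤ ε := Real.sqrt_le_iff.2 ⟨hε, hxu⟩
  have h4 : √(∑ j, (v j - y j) ^ 2) ≤ ε := by
    simp_rw [sub_sq_comm]
    exact Real.sqrt_le_iff.2 ⟨hε, hyv⟩
  have h5 : δ / 2 ≤ √(∑ j, (u j - v j) ^ 2) := by linarith
  calc δ ^ 2 / 4 = (δ / 2) ^ 2 := by ring
    _ ≤ √(∑ j, (u j - v j) ^ 2) ^ 2 := by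
        gcongr
        linarith
    _ = _ := Real.sq_sqrt (Finset.sum_nonneg fun j _ => sq_nonneg _)

lemma l2norm_sub_le_two {x y : Fin n → ℝ} (hx : l2norm x = 1) (hy : l2norm y = 1) :
    l2norm (x - y) ≤ 2 := by
  have h := l2norm_sub_le x 0 y
  simp only [l2norm] at hx hy
  simp only [Pi.zero_apply, sub_zero, zero_sub, neg_sq, hx, hy] at h
  simp only [l2norm, Pi.sub_apply]
  linarith

lemma tessellation_parameters {κ δ M P s : ℝ} (hκ : 0 < κ) (hκ1 : κ ≤ 1) (hδ : 0 < δ)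
    (hδ2 : δ < 2) (hM : 0 < M) (hs : s ≤ 2 * P)
    (hP : 384 / ((κ ^ 2 / 1280) ^ 2 * (κ ^ 2 / 16)) * P ≤ δ ^ 5 * M) :
    s ≤ M ∧ 16 * P ≤ (κ ^ 2 / 1280 * δ ^ 2) ^ 2 * M ∧
      2 * (4 * P / (κ ^ 2 / 1280 * δ ^ 2) ^ 2 + 2 * s) ≤ κ ^ 2 / 32 * δ * M := by
  set c₀ := κ ^ 2 / 1280 with hc₀
  set c₂ := κ ^ 2 / 16 with hc₂
  have hκ2 : κ ^ 2 ≤ 1 := pow_le_one₀ hκ.le hκ1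
  have h0 : 0 < c₀ := by positivity
  have h2 : 0 < c₂ := by positivity
  have h0' : c₀ ≤ 1 / 8 := by linarith
  have h2' : c₂ ≤ 1 := by linarith
  have h00 : c₀ ^ 2 ≤ 1 / 64 := (pow_le_pow_left₀ h0.le h0' 2).trans_eq (by norm_num)
  have hP' : 384 * P ≤ c₀ ^ 2 * c₂ * (δ ^ 5 * M) := by
    rw [div_mul_eq_mul_div, div_le_iff₀ (by positivity)] at hP
    linarith
  have h4 : δ ^ 4 ≤ 16 := (pow_le_pow_left₀ hδ.le hδ2.le 4).trans_eq (by norm_num)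
  have hδM : δ * M ≤ 2 * M := by gcongr
  have hA : δ ^ 5 * M ≤ 16 * (δ * M) := by
    calc δ ^ 5 * M = δ ^ 4 * (δ * M) := by ring
      _ ≤ _ := by gcongr
  have hPM : 384 * P ≤ 1 / 4 * c₂ * (δ * M) := by
    calc 384 * P ≤ c₀ ^ 2 * c₂ * (δ ^ 5 * M) := hP'
      _ ≤ 1 / 64 * c₂ * (16 * (δ * M)) := by gcongr
      _ = _ := by ring
  have hc2M : c₂ * (δ * M) ≤ 1 * (2 * M) := by gcongr
  refine ⟨by linarith, ?_, ?_⟩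
  · have : 384 * P ≤ c₀ ^ 2 * 1 * (δ ^ 4 * (2 * M)) := by
      calc 384 * P ≤ c₀ ^ 2 * c₂ * (δ ^ 5 * M) := hP'
        _ = c₀ ^ 2 * c₂ * (δ ^ 4 * (δ * M)) := by ring
        _ ≤ _ := by gcongr
    have h : (c₀ * δ ^ 2) ^ 2 * M = c₀ ^ 2 * (δ ^ 4 * M) := by ring
    have : 0 < c₀ ^ 2 * (δ ^ 4 * M) := by positivity
    linarith
  · have : P / (c₀ * δ ^ 2) ^ 2 ≤ c₂ * (δ * M) / 384 := by
      rw [div_le_iff₀ (by positivity)]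
      have : c₂ * (δ * M) / 384 * (c₀ * δ ^ 2) ^ 2 = c₀ ^ 2 * c₂ * (δ ^ 5 * M) / 384 := by ring
      linarith
    have hk : κ ^ 2 / 32 * δ * M = c₂ * (δ * M) / 2 := by rw [hc₂]; ring
    have : 0 < c₂ * (δ * M) := by positivity
    rw [hk, mul_div_assoc]
    linarith

lemma ofReal_one_sub_le_measure {Ω : Type*} [MeasurableSpace Ω] {P : Measure Ω}
    [IsProbabilityMeasure P] {S B₁ B₂ : Set Ω} (h : ∀ a, a ∉ B₁ → a ∉ B₂ → a ∈ S) {b : ℝ}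
    (hb : 0 ≤ b) (h₁ : P B₁ ≤ ENNReal.ofReal b) (h₂ : P B₂ ≤ ENNReal.ofReal b) :
    ENNReal.ofReal (1 - 2 * b) ≤ P S := by
  rw [ENNReal.ofReal_sub _ (by positivity), ENNReal.ofReal_one, tsub_le_iff_right]
  have hcover : (Set.univ : Set Ω) ⊆ S ∪ (B₁ ∪ B₂) := fun a _ => by
    by_cases h1 : a ∈ B₁
    · exact .inr (.inl h1)
    by_cases h2 : a ∈ B₂
    · exact .inr (.inr h2)
    exact .inl (h a h1 h2)
  calc (1 : ℝ≥0∞) = P Set.univ := measure_univ.symm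
    _ ≤ P S + (P B₁ + P B₂) := (measure_mono hcover).trans <|
        (measure_union_le _ _).trans <| add_le_add le_rfl (measure_union_le _ _)
    _ ≤ P S + ENNReal.ofReal (2 * b) := by
        rw [two_mul, ENNReal.ofReal_add hb hb]
        gcongr

lemma tessellation_of_large_sample {n m : ℕ} {s δ : ℝ} (hn : 0 < n) (hm : 0 < m) (hs : 0 < s)
    (hsn : s ≤ n) (hδ : 0 < δ) (hδ2 : δ < 2)
    (hP : 384 / ((gaussianPDFReal 0 1 2 ^ 2 / 1280) ^ 2 * (gaussianPDFReal 0 1 2 ^ 2 / 16)) *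
      (s * Real.log (2 * n / s)) ≤ δ ^ 5 * m) :
    ENNReal.ofReal (1 - 2 * Real.exp (-(gaussianPDFReal 0 1 2 ^ 2 / 32) * δ * m)) ≤
      stdGaussianVectors m n {a | ∀ x y : Fin n → ℝ, ∑ j, x j ^ 2 = 1 → ∑ j, y j ^ 2 = 1 →
        ∑ j, |x j| ≤ √s → ∑ j, |y j| ≤ √s → (∀ i, 0 ≤ dot (a i) x * dot (a i) y) →
          l2norm (x - y) ≤ δ} := by
  have hm0 : (0 : ℝ) < m := by exact_mod_cast hm
  have hn0 : (0 : ℝ) < n := by exact_mod_cast hn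
  set κ := gaussianPDFReal 0 1 2
  have hκ : 0 < κ := gaussianPDFReal_pos _ _ _ one_ne_zero
  have hκ1 : κ ≤ 1 := gaussianPDFReal_two_le_one
  have hκ2 : κ ^ 2 ≤ 1 := pow_le_one₀ hκ.le hκ1
  set L := Real.log (2 * n / s)
  have hL : 1 / 2 ≤ L := by
    have h2 : Real.log 2 ≤ L := Real.log_le_log two_pos (by rw [le_div_iff₀ hs]; linarith)
    linarith [Real.log_two_gt_d9]
  have hexpL : Real.exp (-L) = s / (2 * n) := by
    rw [Real.exp_neg, Real.exp_log (by positivity), inv_div]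
  have hsP : s ≤ 2 * (s * L) := by nlinarith
  obtain ⟨hsm, h16, hnetP⟩ := tessellation_parameters hκ hκ1 hδ hδ2 hm0 hsP hP
  set ε := κ ^ 2 / 1280 * δ ^ 2 with hεdef
  have hε : 0 < ε := by positivity
  have hss : 0 < √s := Real.sqrt_pos.2 hs
  have hss2 : √s * √s = s := Real.mul_self_sqrt hs.le
  have hη : 0 < ε ^ 2 / (2 * √s) := by positivity
  obtain ⟨N, hN, hcard, hnet⟩ := exists_net (fun x : Fin n → ℝ => ∑ j, x j ^ 2 = 1) (R := √s)
    hη (show 0 < s / (2 * n) by positivity)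
    (by rw [div_le_div_iff₀ (by positivity) two_pos]; linarith)
  have hcard' : (N.card : ℝ) ≤ Real.exp (4 * (s * L) / ε ^ 2 + 2 * s) := by
    refine hcard.trans_eq ?_
    congr 2
    · rw [one_div_div, div_div_eq_mul_div]
      calc 2 * √s * (2 * √s) / ε ^ 2 * L = 4 * ((√s * √s) * L) / ε ^ 2 := by ring
        _ = _ := by rw [hss2]
    · field_simp
      ring
  have hlamsq : (2 * √L) ^ 2 = 4 * L := by
    rw [mul_pow, Real.sq_sqrt (by linarith)]
    norm_num
  refine ofReal_one_sub_le_measure (fun a h1 h2 => ?_) (Real.exp_pos _).le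
    ((measure_exists_sum_signGap_le N (fun u hu => (hN u hu).1) hδ).trans
      (ENNReal.ofReal_le_ofReal ?_))
    ((measure_exists_softThreshold_le hm (lam := 2 * √L) (by positivity)).trans
      (ENNReal.ofReal_le_ofReal ?_))
  · simp only [Set.mem_ofPred_eq, not_exists, not_and, not_le] at h1 h2
    intro x y hx hy hxR hyR hsign
    refine l2norm_le_of_net hε.le ?_ (fun u hu => (hN u hu).2) ?_
      (fun z => sum_abs_dot_le hm (lam := 2 * √L) (by positivity) hε.le ?_ fun σ => (h2 σ).le)
      ?_ hx hy hxR hyR hsign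
    · have : δ ^ 2 ≤ 2 * δ := by nlinarith
      have : κ ^ 2 * δ ^ 2 ≤ 1 * (2 * δ) := by gcongr
      linarith
    · intro x hx hxR
      obtain ⟨u, hu, hxu⟩ := hnet x hx hxR
      refine ⟨u, hu, hxu.trans_eq ?_⟩
      field_simp
    · refine le_of_sq_le_sq ?_ (by positivity)
      calc (2 * √L * (2 * √s)) ^ 2 = (2 * √L) ^ 2 * (4 * (√s * √s)) := by ring
        _ = 16 * (s * L) := by rw [hlamsq, hss2]; ring
        _ ≤ ε ^ 2 * m := h16
        _ = (ε * √m) ^ 2 := by rw [mul_pow ε, Real.sq_sqrt hm0.le]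
    · intro u hu v hv huv
      refine lt_of_eq_of_lt ?_ (h1 u hu v hv huv)
      rw [hεdef]
      ring
  · calc (N.card : ℝ) ^ 2 * Real.exp (-(κ ^ 2 / 16 * δ * m))
        ≤ Real.exp (4 * (s * L) / ε ^ 2 + 2 * s) ^ 2 * Real.exp (-(κ ^ 2 / 16 * δ * m)) := by
          gcongr
      _ = Real.exp (2 * (4 * (s * L) / ε ^ 2 + 2 * s) - κ ^ 2 / 16 * δ * m) := by
          rw [← Real.exp_nat_mul, ← Real.exp_add]
          rfl
      _ ≤ _ := Real.exp_le_exp.2 (by linarith)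
  · have h2m : (2 : ℝ) ^ m ≤ Real.exp m := by
      rw [← Real.exp_one_pow]
      exact pow_le_pow_left₀ two_pos.le (by linarith [Real.add_one_le_exp 1]) m
    have hns : n * (2 * Real.exp (-(2 * √L) ^ 2 / 4)) = s := by
      rw [hlamsq, show -(4 * L) / 4 = -L by ring, hexpL]
      field_simp
    rw [hns]
    calc 2 ^ m * Real.exp (s - 4 * m) ≤ Real.exp m * Real.exp (s - 4 * m) := by gcongr
      _ = Real.exp (m + (s - 4 * m)) := (Real.exp_add _ _).symm
      _ ≤ _ := Real.exp_le_exp.2 (by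
          have h1 : κ ^ 2 * (δ * m) ≤ 1 * (2 * m) := by gcongr
          linarith)

end Tessellation
/-- **1-bit compressed sensing tessellation theorem (Plan–Vershynin, Theorem 2.1).**
For `n, m, s > 0` with `s ≤ n` and `δ = C̃₁·((s/m)·log(2n/s))^{1/5}`, with probability at
least `1 − C̃₂·exp(−c̃·δ·m)` over i.i.d. standard Gaussian vectors `a₁, …, a_m` in ℝⁿ, the
following holds uniformly over all unit vectors `x, x̂` with `‖x‖₁ ≤ √s` and `‖x̂‖₁ ≤ √s`:
if `⟨a i, x̂⟩·⟨a i, x⟩ ≥ 0` for every `i`, then `‖x̂ − x‖₂ ≤ δ`. -/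
theorem tessellation_of_signs :
    ∃ C₁ C₂ c : ℝ, 0 < C₁ ∧ 0 < C₂ ∧ 0 < c ∧
      ∀ (n m : ℕ) (s : ℝ), 0 < n → 0 < m → 0 < s → s ≤ n →
        ∀ δ : ℝ, δ = C₁ * ((s / m) * Real.log (2 * n / s)) ^ ((1 : ℝ) / 5) →
          stdGaussianVectors m n
              {a : Fin m → Fin n → ℝ |
                ∀ x xhat : Fin n → ℝ,
                  l2norm x = 1 → l2norm xhat = 1 →
                  l1norm x ≤ Real.sqrt s → l1norm xhat ≤ Real.sqrt s →
                  (∀ i, 0 ≤ dot (a i) xhat * dot (a i) x) →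
                  l2norm (xhat - x) ≤ δ} ≥
            ENNReal.ofReal (1 - C₂ * Real.exp (-c * δ * m)) := by
  set κ := gaussianPDFReal 0 1 2
  have hκ : 0 < κ := gaussianPDFReal_pos _ _ _ one_ne_zero
  have hκ2 : κ ^ 2 ≤ 1 := pow_le_one₀ hκ.le gaussianPDFReal_two_le_one
  set D := 384 / ((κ ^ 2 / 1280) ^ 2 * (κ ^ 2 / 16)) with hD
  have hD0 : 0 < D := by positivity
  have hD1 : 1 ≤ D := by
    rw [hD, le_div_iff₀ (by positivity)]
    have h1 : (κ ^ 2 / 1280) ^ 2 ≤ 1 := pow_le_one₀ (by positivity) (by linarith)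
    have h2 : (κ ^ 2 / 1280) ^ 2 * (κ ^ 2 / 16) ≤ 1 * 1 := by
      gcongr
      linarith
    linarith
  refine ⟨D, 2, κ ^ 2 / 32, hD0, two_pos, by positivity, ?_⟩
  rintro n m s hn hm hs hsn δ hδ
  have hm0 : (0 : ℝ) < m := by exact_mod_cast hm
  have hL : 0 < Real.log (2 * n / s) := Real.log_pos (by rw [lt_div_iff₀ hs]; linarith)
  have hδ0 : 0 < δ := by rw [hδ]; positivity
  have hδ5 : δ ^ 5 * m = D ^ 5 * (s * Real.log (2 * n / s)) := by
    rw [hδ, mul_pow, ← Real.rpow_natCast (_ ^ _), ← Real.rpow_mul (by positivity)]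
    norm_num
    field_simp
  have htop : ∀ S : Set (Fin m → Fin n → ℝ), (∀ a, a ∈ S) →
      stdGaussianVectors m n S ≥ ENNReal.ofReal (1 - 2 * Real.exp (-(κ ^ 2 / 32) * δ * m)) := by
    intro S hS
    rw [Set.eq_univ_of_forall hS, measure_univ, ge_iff_le, ENNReal.ofReal_le_one]
    linarith [Real.exp_pos (-(κ ^ 2 / 32) * δ * m)]
  rcases le_or_gt 2 δ with hδ2 | hδ2
  · exact htop _ fun a x y hx hy _ _ _ => (l2norm_sub_le_two hy hx).trans hδ2
  have hP : D * (s * Real.log (2 * n / s)) ≤ δ ^ 5 * m := by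
    rw [hδ5]
    gcongr
    exact le_self_pow₀ hD1 (by norm_num)
  refine (tessellation_of_large_sample hn hm hs hsn hδ0 hδ2 hP).trans (measure_mono ?_)
  intro a ha x y hx hy hx1 hy1 hsign
  exact ha y x (Real.sqrt_eq_one.1 hy) (Real.sqrt_eq_one.1 hx) hy1 hx1 hsign
end

section
/- Let x0, h, φ ∈ ℝⁿ with ‖x0‖₂ = ‖φ‖₂ = 1, let α = ⟨φ, x0⟩ with 0 < α ≤ 1, let Ω = supp(x0) with |Ω| ≤ k, let λ > 0 and set ξ = λ√k, and assume ξ < (3/4)·α. If ⟨φ, h⟩ ≥ λ·⟨sign(x0), h_Ω⟩ + λ·‖h_{Ω^c}‖₁, then ‖h_{Ω^c}‖₁ ≤ ((11/4)/ξ)·√k·‖h‖₂. -/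
theorem l2norm_nonneg {n : ℕ} (x : Fin n → ℝ) : 0 ≤ l2norm x := Real.sqrt_nonneg _

/-- The Cauchy–Schwarz inequality. -/
theorem abs_dot_le_l2norm_mul_l2norm {n : ℕ} (x y : Fin n → ℝ) :
    |dot x y| ≤ l2norm x * l2norm y := by
  unfold dot l2norm
  rw [← Real.sqrt_mul (Finset.sum_nonneg fun _ _ => sq_nonneg _)]
  exact Real.abs_le_sqrt (Finset.sum_mul_sq_le_sq_mul_sq _ _ _)

theorem dot_sign_indicator_support {n : ℕ} (x h : Fin n → ℝ) :
    dot (fun j => Real.sign (x j)) ((Function.support x).indicator h) =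
      dot (fun j => Real.sign (x j)) h := by
  unfold dot
  refine Finset.sum_congr rfl fun j _ => ?_
  by_cases hj : x j = 0 <;> simp [Set.indicator, hj]

theorem l2norm_sign {n : ℕ} (x : Fin n → ℝ) :
    l2norm (fun j => Real.sign (x j)) = Real.sqrt (Function.support x).ncard := by
  classical
  have key : ∀ j, Real.sign (x j) ^ 2 = if x j ≠ 0 then 1 else 0 := by
    intro j
    rcases lt_trichotomy (x j) 0 with hj | hj | hj
    · simp [Real.sign_of_neg hj, hj.ne]
    · simp [hj]
    · simp [Real.sign_of_pos hj, hj.ne']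
  have hsupp : Function.support x = ↑(Finset.univ.filter fun j => x j ≠ 0) := by
    ext j
    simp
  unfold l2norm
  rw [hsupp, Set.ncard_coe_finset]
  simp only [key, Finset.sum_boole]

theorem support_ncard_pos_of_l2norm_eq_one {n : ℕ} {x : Fin n → ℝ} (hx : l2norm x = 1) :
    0 < (Function.support x).ncard := by
  rw [Set.ncard_pos, Function.support_nonempty_iff]
  rintro rfl
  simp [l2norm] at hx

/-- **Pre-tessellation bound (inequality (5) of the paper).** With `‖x0‖₂ = ‖φ‖₂ = 1`,
`α = ⟨φ, x0⟩ ∈ (0, 1]`, `Ω = supp(x0)`, `|Ω| ≤ k`, `ξ = λ√k`, and `ξ < (3/4)·α`, the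
subgradient inequality `⟨φ, h⟩ ≥ λ·⟨sign(x0), h_Ω⟩ + λ·‖h_{Ω^c}‖₁` implies
`‖h_{Ω^c}‖₁ ≤ ((11/4)/ξ)·√k·‖h‖₂`. -/
theorem homegac_l1_bound_preyaniv {n k : ℕ} (x0 h φ : Fin n → ℝ) (lam α ξ : ℝ)
    (hx0 : l2norm x0 = 1) (hφ : l2norm φ = 1) (hα : α = dot φ x0)
    (hαpos : 0 < α) (hα1 : α ≤ 1)
    (hk : (Function.support x0).ncard ≤ k)
    (hlam : 0 < lam) (hξ : ξ = lam * Real.sqrt k) (hξα : ξ < (3 / 4) * α)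
    (hsub : dot φ h ≥
      lam * dot (fun j => Real.sign (x0 j)) ((Function.support x0).indicator h) +
        lam * l1norm ((Function.support x0)ᶜ.indicator h)) :
    l1norm ((Function.support x0)ᶜ.indicator h) ≤
      ((11 / 4) / ξ) * Real.sqrt k * l2norm h := by
  have hkpos : (0 : ℝ) < Real.sqrt k :=
    Real.sqrt_pos.2 (by exact_mod_cast (support_ncard_pos_of_l2norm_eq_one hx0).trans_le hk)
  have hsign : l2norm (fun j => Real.sign (x0 j)) ≤ Real.sqrt k := by
    rw [l2norm_sign]
    exact Real.sqrt_le_sqrt (by exact_mod_cast hk)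
  have hnorm := l2norm_nonneg h
  have hφh : dot φ h ≤ l2norm h := by
    simpa [hφ] using (le_abs_self _).trans (abs_dot_le_l2norm_mul_l2norm φ h)
  have hsh : -(Real.sqrt k * l2norm h) ≤ dot (fun j => Real.sign (x0 j)) h :=
    neg_le_of_abs_le ((abs_dot_le_l2norm_mul_l2norm _ h).trans
      (mul_le_mul_of_nonneg_right hsign hnorm))
  rw [dot_sign_indicator_support] at hsub
  have hscale : (11 / 4) / ξ * Real.sqrt k * l2norm h = (11 / 4) * l2norm h / lam := by
    rw [hξ]
    field_simp
  rw [hscale, le_div_iff₀ hlam]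
  have hlsh := mul_le_mul_of_nonneg_left hsh hlam.le
  have hξh : lam * Real.sqrt k * l2norm h ≤ 3 / 4 * l2norm h :=
    mul_le_mul_of_nonneg_right (by linarith) hnorm
  linarith
end
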